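/- arXiv:math/9802121 — 2 statements merged into one kernel-verified Lean document; each statement's English description precedes it below -/
import Mathlib

section
/- Let Λ ⊂ ℝⁿ be a full-rank lattice with shortest nonzero vector length λ₁(Λ), and for t ≥ 1 let Λ_t = t·Λ. Then as t → ∞, −(1/t²) · log(Σ_{x∈Λ_t, x≠0} e^{−π‖x‖²}) → π λ₁(Λ)²; i.e. the Gaussian-weighted size of a rescaled lattice detects the Hermite minimum. -/
open Real Filter

/-- The Gaussian `x ↦ e^{-π‖x‖²}` is summable over a discrete subgroup of a Euclidean space. -/
lemma summable_exp_neg_pi_norm_sq {E : Type*} [NormedAddCommGroup E] [NormedSpace ℝ E]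
    [FiniteDimensional ℝ E] (L : Submodule ℤ E) [DiscreteTopology L] :
    Summable fun x : L => Real.exp (-π * ‖x‖ ^ 2) := by
  set m := Module.finrank ℤ L + 1
  have hs : Summable fun x : L => ‖x‖⁻¹ ^ (2 * m) :=
    ZLattice.summable_norm_pow_inv L (2 * m) (by omega)
  refine Summable.of_norm_bounded_eventually (hs.mul_left (m.factorial / π ^ m)) ?_
  refine (Set.finite_singleton (0 : L)).subset fun x hx => ?_
  by_contra hx0
  refine hx ?_
  have hpos : 0 < ‖x‖ := norm_pos_iff.mpr hx0
  have h := Real.pow_div_factorial_le_exp (x := π * ‖x‖ ^ 2) (by positivity) m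
  rw [Set.mem_ofPred_eq, Real.norm_of_nonneg (Real.exp_pos _).le, neg_mul, Real.exp_neg]
  calc (Real.exp (π * ‖x‖ ^ 2))⁻¹ ≤ ((π * ‖x‖ ^ 2) ^ m / m.factorial)⁻¹ :=
        inv_anti₀ (by positivity) h
    _ = m.factorial / π ^ m * ‖x‖⁻¹ ^ (2 * m) := by
        rw [mul_pow, ← pow_mul, inv_pow, inv_div]
        field_simp

/-- If `‖f i‖ ≥ m` with equality attained, the sums of `e^{-π‖t f i‖²}` lie between
`e^{-πt²m²}` and `e^{-π(t²-1)m²}` times the value at `t = 1`. -/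
lemma tsum_exp_neg_pi_norm_smul_sq_bounds {ι E : Type*} [NormedAddCommGroup E] [NormedSpace ℝ E]
    {f : ι → E} (hf : Summable fun i => Real.exp (-π * ‖f i‖ ^ 2)) {m : ℝ} (hm0 : 0 ≤ m)
    (hm : ∀ i, m ≤ ‖f i‖) {i₀ : ι} (hi₀ : ‖f i₀‖ = m) {t : ℝ} (ht : 1 ≤ t) :
    Real.exp (-π * t ^ 2 * m ^ 2) ≤ ∑' i, Real.exp (-π * ‖t • f i‖ ^ 2) ∧
      ∑' i, Real.exp (-π * ‖t • f i‖ ^ 2) ≤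
        Real.exp (-π * (t ^ 2 - 1) * m ^ 2) * ∑' i, Real.exp (-π * ‖f i‖ ^ 2) := by
  have hle (i : ι) : Real.exp (-π * ‖t • f i‖ ^ 2) ≤
      Real.exp (-π * (t ^ 2 - 1) * m ^ 2) * Real.exp (-π * ‖f i‖ ^ 2) := by
    rw [← Real.exp_add, Real.exp_le_exp, norm_smul, mul_pow, Real.norm_eq_abs, sq_abs]
    have h1 : m ^ 2 ≤ ‖f i‖ ^ 2 := pow_le_pow_left₀ hm0 (hm i) 2
    have h2 : 0 ≤ π * (t ^ 2 - 1) := mul_nonneg pi_pos.le (by nlinarith)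
    nlinarith [mul_le_mul_of_nonneg_left h1 h2]
  have hs : Summable fun i => Real.exp (-π * ‖t • f i‖ ^ 2) :=
    (hf.mul_left _).of_nonneg_of_le (fun _ => (Real.exp_pos _).le) hle
  constructor
  · refine le_trans (le_of_eq ?_) (hs.le_tsum i₀ fun _ _ => (Real.exp_pos _).le)
    rw [norm_smul, mul_pow, Real.norm_eq_abs, sq_abs, hi₀, mul_assoc]
  · rw [← tsum_mul_left]
    exact hs.tsum_le_tsum hle (hf.mul_left _)

/-- If `λ₁` is the length of a shortest nonzero vector of a full-rank lattice `Λ ⊂ ℝⁿ`,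
then `-(1/t²) log (∑_{x ∈ tΛ, x ≠ 0} e^{-π‖x‖²}) → π λ₁²` as `t → ∞`. -/
theorem scaled_lattice_gaussian_detects_minimum {n : ℕ}
    (L : Submodule ℤ (EuclideanSpace ℝ (Fin n))) [DiscreteTopology L] [IsZLattice ℝ L]
    (lam : ℝ)
    (hlam : IsLeast {r : ℝ | ∃ x ∈ L, x ≠ 0 ∧ ‖x‖ = r} lam) :
    Tendsto
      (fun t : ℝ =>
        -(1 / t ^ 2) * Real.log (∑' x : {x : L // x ≠ 0},
          Real.exp (-π * ‖t • ((x : L) : EuclideanSpace ℝ (Fin n))‖ ^ 2)))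
      atTop (nhds (π * lam ^ 2)) := by
  obtain ⟨⟨x₀, hx₀, hne, hnorm⟩, hmin⟩ := hlam
  have hf : Summable fun x : {x : L // x ≠ 0} =>
      Real.exp (-π * ‖((x : L) : EuclideanSpace ℝ (Fin n))‖ ^ 2) :=
    (summable_exp_neg_pi_norm_sq L).subtype {x : L | x ≠ 0}
  have hm (x : {x : L // x ≠ 0}) : lam ≤ ‖((x : L) : EuclideanSpace ℝ (Fin n))‖ :=
    hmin ⟨x, x.1.2, fun h => x.2 (Subtype.ext h), rfl⟩
  have bounds {t : ℝ} (ht : 1 ≤ t) := tsum_exp_neg_pi_norm_smul_sq_bounds hf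
    (hnorm ▸ norm_nonneg x₀) hm
    (i₀ := ⟨⟨x₀, hx₀⟩, fun h => hne (congrArg Subtype.val h)⟩) hnorm ht
  set S := ∑' x : {x : L // x ≠ 0}, Real.exp (-π * ‖((x : L) : EuclideanSpace ℝ (Fin n))‖ ^ 2)
  have hS : 0 < S := by
    have h := bounds le_rfl
    exact pos_of_mul_pos_right ((Real.exp_pos _).trans_le (h.1.trans h.2)) (Real.exp_pos _).le
  have hinv : Tendsto (fun t : ℝ => 1 / t ^ 2) atTop (nhds 0) := by
    simpa [Function.comp_def] using tendsto_inv_atTop_zero.comp (tendsto_pow_atTop (α := ℝ) two_ne_zero)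
  have hlower : Tendsto (fun t : ℝ => π * lam ^ 2 - 1 / t ^ 2 * (π * lam ^ 2 + Real.log S))
      atTop (nhds (π * lam ^ 2)) := by
    simpa using (hinv.mul_const (π * lam ^ 2 + Real.log S)).const_sub (π * lam ^ 2)
  refine tendsto_of_tendsto_of_tendsto_of_le_of_le' hlower tendsto_const_nhds ?_ ?_
  · filter_upwards [eventually_ge_atTop 1] with t ht
    have h := bounds ht
    have ht2 : 0 < t ^ 2 := by positivity
    have hlog := Real.log_le_log ((Real.exp_pos _).trans_le h.1) h.2
    rw [Real.log_mul (Real.exp_pos _).ne' hS.ne', Real.log_exp] at hlog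
    have := mul_le_mul_of_nonneg_left hlog (one_div_pos.mpr ht2).le
    have he : 1 / t ^ 2 * (-π * (t ^ 2 - 1) * lam ^ 2 + Real.log S) =
        -(π * lam ^ 2 - 1 / t ^ 2 * (π * lam ^ 2 + Real.log S)) := by
      field_simp
      ring
    linarith
  · filter_upwards [eventually_ge_atTop 1] with t ht
    have ht2 : 0 < t ^ 2 := by positivity
    have hlog := Real.log_le_log (Real.exp_pos _) (bounds ht).1
    rw [Real.log_exp] at hlog
    have := mul_le_mul_of_nonneg_left hlog (one_div_pos.mpr ht2).le
    have he : 1 / t ^ 2 * (-π * t ^ 2 * lam ^ 2) = -(π * lam ^ 2) := by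
      field_simp
    linarith
end

section
/- Let Λ ⊂ ℝⁿ be a full-rank lattice and c > 0. Then Σ_{x∈Λ} e^{−π c ‖x‖²} ≤ max(1, c^{−n/2}) · Σ_{x∈Λ} e^{−π‖x‖²}. -/
open Real

section PositiveDefiniteness

variable {G : Type*} [AddCommGroup G]

lemma summable_mul_add_sub {f g : G → ℝ} (h2 : Function.Injective fun a : G ↦ 2 • a)
    (hf : Summable f) (hg : Summable g) :
    Summable fun p : G × G ↦ f (p.1 + p.2) * g (p.1 - p.2) := by
  have hinj : Function.Injective fun p : G × G ↦ (p.1 + p.2, p.1 - p.2) := by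
    intro p q h
    have h₁ : p.1 + p.2 = q.1 + q.2 := congrArg Prod.fst h
    have h₂ : p.1 - p.2 = q.1 - q.2 := congrArg Prod.snd h
    have hfst : p.1 = q.1 := h2 <| calc
      2 • p.1 = (p.1 + p.2) + (p.1 - p.2) := by rw [two_nsmul]; abel
      _ = 2 • q.1 := by rw [h₁, h₂, two_nsmul]; abel
    rw [hfst] at h₁
    exact Prod.ext hfst (add_left_cancel h₁)
  have hcomp : Summable ((fun q : G × G ↦ f q.1 * g q.2) ∘
      fun p : G × G ↦ (p.1 + p.2, p.1 - p.2)) :=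
    (summable_mul_of_summable_norm hf.norm hg.norm).comp_injective hinj
  exact hcomp

lemma tsum_mul_tsum_addSubgroup_nonneg (s : AddSubgroup G) (h : G → ℝ)
    (hs : Summable fun g ↦ h g * ∑' n : s, h (g + n)) :
    0 ≤ ∑' g, h g * ∑' n : s, h (g + n) := by
  have hbij : Function.Bijective fun p : (G ⧸ s) × s ↦ p.1.out + (p.2 : G) := by
    refine ⟨?_, fun g ↦ ⟨(g, ⟨-(g : G ⧸ s).out + g, ?_⟩), by simp⟩⟩
    · rintro ⟨q, m⟩ ⟨q', m'⟩ h
      have hq : q = q' := by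
        simpa using congrArg (QuotientAddGroup.mk : G → G ⧸ s) h
      subst hq
      simpa using h
    · exact QuotientAddGroup.eq.mp (Quotient.out_eq' _)
  let e := Equiv.ofBijective _ hbij
  have he : ∀ p : (G ⧸ s) × s, e p = p.1.out + p.2 := fun _ ↦ rfl
  have hper : ∀ (g : G) (m : s), ∑' n : s, h (g + m + n) = ∑' n : s, h (g + n) := fun g m ↦ by
    rw [← (Equiv.addLeft m).tsum_eq fun n : s ↦ h (g + n)]
    simp [add_assoc]
  rw [← e.tsum_eq]
  have hs' := e.summable_iff.mpr hs
  refine (hs'.tsum_prod).symm ▸ tsum_nonneg fun q ↦ ?_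
  simp only [he, hper, Function.comp_apply, tsum_mul_right]
  exact mul_self_nonneg _

lemma tsum_mul_add_sub_nonneg (h2 : Function.Injective fun a : G ↦ 2 • a) {h : G → ℝ}
    (hh : Summable h) : 0 ≤ ∑' p : G × G, h (p.1 + p.2) * h (p.1 - p.2) := by
  let φ : G →+ G := nsmulAddMonoidHom 2
  have hφ : Function.Injective φ := h2
  let e : G × G ≃ G × G :=
    { toFun := fun p ↦ (p.1 + p.2, p.2)
      invFun := fun p ↦ (p.1 - p.2, p.2)
      left_inv := fun p ↦ by simp
      right_inv := fun p ↦ by simp }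
  have hF := e.summable_iff.mpr (summable_mul_add_sub h2 hh hh)
  have hinner : ∀ v : G, ∑' b : G, h ((e (v, b)).1 + (e (v, b)).2) *
      h ((e (v, b)).1 - (e (v, b)).2) = h v * ∑' n : φ.range, h (v + n) := fun v ↦ by
    rw [← (AddMonoidHom.ofInjective hφ).toEquiv.tsum_eq, ← tsum_mul_left]
    refine tsum_congr fun b ↦ ?_
    have hb : ((AddMonoidHom.ofInjective hφ b : φ.range) : G) = b + b := two_nsmul b
    simp [e, hb, mul_comm, add_assoc]
  have hsum := hF.prod
  simp only [Function.comp_apply, hinner] at hsum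
  rw [← e.tsum_eq]
  refine (hF.tsum_prod).symm ▸ ?_
  simp only [Function.comp_apply, hinner]
  exact tsum_mul_tsum_addSubgroup_nonneg _ _ hsum

end PositiveDefiniteness

section GaussianSum

lemma exp_neg_mul_norm_add_sq_le {E : Type*} [NormedAddCommGroup E] {b : ℝ} (hb : 0 < b) (x y : E) :
    rexp (-b * ‖x + y‖ ^ 2) ≤ rexp (b * ‖y‖ ^ 2) * rexp (-(b / 2) * ‖x‖ ^ 2) := by
  rw [← Real.exp_add, Real.exp_le_exp]
  have h : ‖x‖ ≤ ‖x + y‖ + ‖y‖ := by simpa using norm_sub_le (x + y) y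
  have h' : ‖x‖ ^ 2 ≤ 2 * ‖x + y‖ ^ 2 + 2 * ‖y‖ ^ 2 := by
    nlinarith [sq_nonneg (‖x + y‖ - ‖y‖), norm_nonneg x]
  nlinarith

variable {E : Type*} [NormedAddCommGroup E] [InnerProductSpace ℝ E]

lemma exp_neg_mul_norm_add_sq_mul_exp {b t : ℝ} (ht : 0 < t) (x v : E) :
    rexp (-b * ‖x + v‖ ^ 2) * rexp (-(b * t) * ‖v‖ ^ 2) =
      rexp (-(b * (t / (1 + t))) * ‖x‖ ^ 2) *
        rexp (-(b * (1 + t)) * ‖v + (1 + t)⁻¹ • x‖ ^ 2) := by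
  rw [← Real.exp_add, ← Real.exp_add, norm_add_sq_real, norm_add_sq_real, norm_smul,
    inner_smul_right, real_inner_comm, Real.norm_of_nonneg (by positivity)]
  congr 1
  field_simp
  ring

variable [FiniteDimensional ℝ E] (L : Submodule ℤ E) [DiscreteTopology L]

lemma summable_exp_neg_mul_norm_sq {b : ℝ} (hb : 0 < b) :
    Summable fun x : L ↦ rexp (-b * ‖(x : E)‖ ^ 2) := by
  set m := Module.finrank ℤ L + 1
  refine Summable.of_norm_bounded_eventually
    ((ZLattice.summable_norm_pow_inv L (2 * m) (by omega)).mul_left (m.factorial / b ^ m)) ?_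
  have h0 : ∀ᶠ x : L in Filter.cofinite, x ≠ 0 := by
    simp [Filter.eventually_cofinite]
  filter_upwards [h0] with x hx
  have hx' : 0 < ‖(x : E)‖ := by simpa using hx
  have h := Real.pow_div_factorial_le_exp (b * ‖(x : E)‖ ^ 2) (by positivity) m
  rw [Real.norm_of_nonneg (Real.exp_nonneg _), neg_mul, Real.exp_neg]
  refine (inv_anti₀ (by positivity) h).trans_eq ?_
  rw [Submodule.coe_norm, inv_pow, pow_mul, mul_pow]
  field_simp

lemma summable_exp_neg_mul_norm_add_sq {b : ℝ} (hb : 0 < b) (y : E) :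
    Summable fun x : L ↦ rexp (-b * ‖(x : E) + y‖ ^ 2) :=
  .of_nonneg_of_le (fun _ ↦ Real.exp_nonneg _) (fun _ ↦ exp_neg_mul_norm_add_sq_le hb _ y)
    ((summable_exp_neg_mul_norm_sq L (half_pos hb)).mul_left _)

lemma exists_forall_tsum_exp_neg_mul_norm_add_sq_le [IsZLattice ℝ L] {b : ℝ} (hb : 0 < b) :
    ∃ M, ∀ y : E, ∑' x : L, rexp (-b * ‖(x : E) + y‖ ^ 2) ≤ M := by
  have := ZLattice.module_free ℝ L
  let B := (Module.Free.chooseBasis ℤ L).ofZLatticeBasis ℝ L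
  refine ⟨rexp (b * (∑ i, ‖B i‖) ^ 2) * ∑' x : L, rexp (-(b / 2) * ‖(x : E)‖ ^ 2), fun y ↦ ?_⟩
  have hmem : (ZSpan.floor B y : E) ∈ L := by
    exact (Module.Basis.ofZLatticeBasis_span ℝ L (Module.Free.chooseBasis ℤ L)).le
      (ZSpan.floor B y).2
  rw [← (Equiv.subRight (⟨_, hmem⟩ : L)).tsum_eq, ← tsum_mul_left]
  have hsh : ∀ x : L, ((Equiv.subRight (⟨_, hmem⟩ : L) x : L) : E) + y =
      (x : E) + ZSpan.fract B y := fun x ↦ by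
    simp [ZSpan.fract_apply]
    abel
  simp only [hsh]
  refine (summable_exp_neg_mul_norm_add_sq L hb _).tsum_le_tsum (fun x ↦ ?_)
    ((summable_exp_neg_mul_norm_sq L (half_pos hb)).mul_left _)
  refine (exp_neg_mul_norm_add_sq_le hb _ _).trans ?_
  gcongr
  exact ZSpan.norm_fract_le B y

lemma two_mul_tsum_exp_neg_mul_norm_add_sq_sq_le {b : ℝ} (hb : 0 < b) (y : E) :
    2 * (∑' x : L, rexp (-b * ‖(x : E) + y‖ ^ 2)) ^ 2 ≤
      (∑' x : L, rexp (-b * ‖(x : E) + (2 : ℕ) • y‖ ^ 2)) *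
        (∑' x : L, rexp (-b * ‖(x : E)‖ ^ 2)) +
      (∑' x : L, rexp (-b * ‖(x : E)‖ ^ 2)) ^ 2 := by
  have h2 : Function.Injective fun a : L ↦ 2 • a := by
    intro a c h
    have h' : (2 : ℝ) • (a : E) = (2 : ℝ) • (c : E) := by
      have := congrArg (Subtype.val : L → E) h
      simpa [two_smul] using this
    exact Subtype.ext (smul_right_injective E two_ne_zero h')
  let f : L → ℝ := fun u ↦ rexp (-(b / 2) * ‖(u : E) + (2 : ℕ) • y‖ ^ 2)
  let g : L → ℝ := fun u ↦ rexp (-(b / 2) * ‖(u : E)‖ ^ 2)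
  have hf : Summable f := summable_exp_neg_mul_norm_add_sq L (half_pos hb) _
  have hg : Summable g := summable_exp_neg_mul_norm_sq L (half_pos hb)
  let S (z : E) : L → ℝ := fun x ↦ rexp (-b * ‖(x : E) + z‖ ^ 2)
  have hS : ∀ z, Summable (S z) := fun z ↦ summable_exp_neg_mul_norm_add_sq L hb z
  have hprod : ∀ z w : E, (∑' x, S z x) * ∑' x, S w x = ∑' p : L × L, S z p.1 * S w p.2 :=
    fun z w ↦ tsum_mul_tsum_of_summable_norm (hS z).norm (hS w).norm
  have key : ∀ u v z w : E, u + v = z → u - v = w →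
      rexp (-(b / 2) * ‖z‖ ^ 2) * rexp (-(b / 2) * ‖w‖ ^ 2) =
        rexp (-b * ‖u‖ ^ 2) * rexp (-b * ‖v‖ ^ 2) := by
    rintro u v _ _ rfl rfl
    rw [← Real.exp_add, ← Real.exp_add]
    congr 1
    linear_combination (-(b / 2)) * parallelogram_law_with_norm ℝ u v
  have hff : ∀ p : L × L, f (p.1 + p.2) * f (p.1 - p.2) = S ((2 : ℕ) • y) p.1 * S 0 p.2 :=
    fun p ↦ key _ _ _ _ (by push_cast; abel) (by push_cast; abel)
  have hgg : ∀ p : L × L, g (p.1 + p.2) * g (p.1 - p.2) = S 0 p.1 * S 0 p.2 :=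
    fun p ↦ key _ _ _ _ (by push_cast; abel) (by push_cast; abel)
  have hfg : ∀ p : L × L, f (p.1 + p.2) * g (p.1 - p.2) = S y p.1 * S y p.2 :=
    fun p ↦ key _ _ _ _ (by push_cast; abel) (by push_cast; abel)
  have hgf : ∀ p : L × L, g (p.1 + p.2) * f (p.1 - p.2) = S y p.1 * S (-y) p.2 :=
    fun p ↦ key _ _ _ _ (by push_cast; abel) (by push_cast; abel)
  have hneg : ∑' x, S (-y) x = ∑' x, S y x := by
    rw [← (Equiv.neg L).tsum_eq]
    refine tsum_congr fun x ↦ ?_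
    simp only [S, Equiv.neg_apply, Submodule.coe_neg, ← neg_add, norm_neg]
  have hpos := tsum_mul_add_sub_nonneg h2 (hf.sub hg)
  have hexp : ∀ p : L × L, (f (p.1 + p.2) - g (p.1 + p.2)) * (f (p.1 - p.2) - g (p.1 - p.2)) =
      (S ((2 : ℕ) • y) p.1 * S 0 p.2 + S 0 p.1 * S 0 p.2) -
        (S y p.1 * S y p.2 + S y p.1 * S (-y) p.2) := fun p ↦ by
    rw [← hff, ← hgg, ← hfg, ← hgf]
    ring
  have hsm : ∀ z w : E, Summable fun p : L × L ↦ S z p.1 * S w p.2 :=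
    fun z w ↦ summable_mul_of_summable_norm (hS z).norm (hS w).norm
  simp only [hexp] at hpos
  rw [((hsm _ _).add (hsm _ _)).tsum_sub ((hsm _ _).add (hsm _ _)), (hsm _ _).tsum_add (hsm _ _),
    (hsm _ _).tsum_add (hsm _ _), ← hprod, ← hprod, ← hprod, ← hprod, hneg] at hpos
  simp only [S, add_zero] at hpos
  linarith

theorem tsum_exp_neg_mul_norm_add_sq_le [IsZLattice ℝ L] {b : ℝ} (hb : 0 < b) (y : E) :
    ∑' x : L, rexp (-b * ‖(x : E) + y‖ ^ 2) ≤ ∑' x : L, rexp (-b * ‖(x : E)‖ ^ 2) := by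
  obtain ⟨M, hM⟩ := exists_forall_tsum_exp_neg_mul_norm_add_sq_le L hb
  have hstep := two_mul_tsum_exp_neg_mul_norm_add_sq_sq_le L hb
  set A : E → ℝ := fun y ↦ ∑' x : L, rexp (-b * ‖(x : E) + y‖ ^ 2)
  set A₀ := ∑' x : L, rexp (-b * ‖(x : E)‖ ^ 2)
  have hA₀ : 0 ≤ A₀ := tsum_nonneg fun _ ↦ Real.exp_nonneg _
  have hbdd : BddAbove (Set.range A) := ⟨M, by rintro _ ⟨z, rfl⟩; exact hM z⟩
  have hle : ∀ z, A z ≤ ⨆ z, A z := le_ciSup hbdd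
  have hnn : ∀ z, 0 ≤ A z := fun z ↦ tsum_nonneg fun _ ↦ Real.exp_nonneg _
  set s := ⨆ z, A z
  have hs : s ≤ √((s * A₀ + A₀ ^ 2) / 2) := ciSup_le fun z ↦ Real.le_sqrt_of_sq_le (by
    have h₁ : 2 * A z ^ 2 ≤ A ((2 : ℕ) • z) * A₀ + A₀ ^ 2 := hstep z
    have h₂ := mul_le_mul_of_nonneg_right (hle ((2 : ℕ) • z)) hA₀
    linarith)
  have hs0 : 0 ≤ s := (hnn 0).trans (hle 0)
  have hsq : s ^ 2 ≤ (s * A₀ + A₀ ^ 2) / 2 := (Real.le_sqrt hs0 (by positivity)).mp hs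
  refine (hle y).trans ?_
  by_contra! hlt
  nlinarith

variable [MeasurableSpace E] [BorelSpace E]

lemma integrable_exp_neg_mul_norm_sq {b : ℝ} (hb : 0 < b) :
    MeasureTheory.Integrable fun v : E ↦ rexp (-b * ‖v‖ ^ 2) := by
  refine MeasureTheory.Integrable.of_integral_ne_zero ?_
  rw [GaussianFourier.integral_rexp_neg_mul_sq_norm hb]
  positivity

lemma integrable_exp_neg_mul_norm_add_sq_mul_exp {b t : ℝ} (hb : 0 < b) (ht : 0 < t) (x : E) :
    MeasureTheory.Integrable fun v : E ↦
      rexp (-b * ‖x + v‖ ^ 2) * rexp (-(b * t) * ‖v‖ ^ 2) := by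
  simp only [exp_neg_mul_norm_add_sq_mul_exp ht]
  exact ((integrable_exp_neg_mul_norm_sq (by positivity)).comp_add_right _).const_mul _

lemma integral_exp_neg_mul_norm_add_sq_mul_exp {b t : ℝ} (hb : 0 < b) (ht : 0 < t) (x : E) :
    ∫ v : E, rexp (-b * ‖x + v‖ ^ 2) * rexp (-(b * t) * ‖v‖ ^ 2) =
      rexp (-(b * (t / (1 + t))) * ‖x‖ ^ 2) *
        (π / (b * (1 + t))) ^ (Module.finrank ℝ E / 2 : ℝ) := by
  simp only [exp_neg_mul_norm_add_sq_mul_exp ht]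
  rw [MeasureTheory.integral_const_mul,
    MeasureTheory.integral_add_right_eq_self fun v : E ↦ rexp (-(b * (1 + t)) * ‖v‖ ^ 2),
    GaussianFourier.integral_rexp_neg_mul_sq_norm (by positivity)]

theorem tsum_exp_neg_mul_norm_sq_le_rpow_mul [IsZLattice ℝ L] {b c : ℝ} (hb : 0 < b)
    (hc : 0 < c) (hc1 : c < 1) :
    ∑' x : L, rexp (-(b * c) * ‖(x : E)‖ ^ 2) ≤
      c ^ (-(Module.finrank ℝ E : ℝ) / 2) * ∑' x : L, rexp (-b * ‖(x : E)‖ ^ 2) := by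
  set d : ℝ := Module.finrank ℝ E / 2 with hd
  set A₀ := ∑' x : L, rexp (-b * ‖(x : E)‖ ^ 2)
  have h1c : 0 < 1 - c := by linarith
  obtain ⟨t, ht⟩ : ∃ t, t = c / (1 - c) := ⟨_, rfl⟩
  have ht0 : 0 < t := ht ▸ div_pos hc h1c
  have htc : t / (1 + t) = c := by
    rw [ht]
    field_simp
    ring
  refine (summable_exp_neg_mul_norm_sq L (by positivity)).tsum_le_of_sum_le fun s ↦ ?_
  set K := (π / (b * (1 + t))) ^ d with hK
  have hK0 : 0 < K := by positivity
  have hint : (∑ x ∈ s, rexp (-(b * c) * ‖(x : E)‖ ^ 2)) * K ≤ A₀ * (π / (b * t)) ^ d := by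
    calc (∑ x ∈ s, rexp (-(b * c) * ‖(x : E)‖ ^ 2)) * K
        = ∫ v : E, ∑ x ∈ s, rexp (-b * ‖(x : E) + v‖ ^ 2) * rexp (-(b * t) * ‖v‖ ^ 2) := by
          rw [MeasureTheory.integral_finsetSum _ fun x _ ↦
            integrable_exp_neg_mul_norm_add_sq_mul_exp hb ht0 _, Finset.sum_mul]
          simp only [integral_exp_neg_mul_norm_add_sq_mul_exp hb ht0, htc, hK, hd]
      _ ≤ ∫ v : E, A₀ * rexp (-(b * t) * ‖v‖ ^ 2) := by
          refine MeasureTheory.integral_mono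
            (MeasureTheory.integrable_finsetSum _ fun x _ ↦
              integrable_exp_neg_mul_norm_add_sq_mul_exp hb ht0 _)
            ((integrable_exp_neg_mul_norm_sq (by positivity)).const_mul _) fun v ↦ ?_
          simp only [← Finset.sum_mul]
          gcongr
          exact ((summable_exp_neg_mul_norm_add_sq L hb v).sum_le_tsum s
            fun _ _ ↦ Real.exp_nonneg _).trans (tsum_exp_neg_mul_norm_add_sq_le L hb v)
      _ = A₀ * (π / (b * t)) ^ d := by
          rw [MeasureTheory.integral_const_mul,
            GaussianFourier.integral_rexp_neg_mul_sq_norm (by positivity)]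
  have hratio : (π / (b * t)) ^ d = c ^ (-(Module.finrank ℝ E : ℝ) / 2) * K := by
    rw [neg_div, Real.rpow_neg hc.le, ← Real.inv_rpow hc.le, ← Real.mul_rpow (by positivity)
      (by positivity), ← htc]
    congr 1
    field_simp
  refine le_of_mul_le_mul_right (hint.trans_eq ?_) hK0
  rw [hratio]
  ring

end GaussianSum

/-- For a full-rank lattice `Λ ⊂ ℝⁿ` and `c > 0`,
`∑_{x ∈ Λ} e^{-π c ‖x‖²} ≤ max (1, c^{-n/2}) ∑_{x ∈ Λ} e^{-π‖x‖²}`. -/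
theorem lattice_gaussian_scaling_comparison {n : ℕ}
    (L : Submodule ℤ (EuclideanSpace ℝ (Fin n))) [DiscreteTopology L] [IsZLattice ℝ L]
    (c : ℝ) (hc : 0 < c) :
    (∑' x : L, Real.exp (-π * c * ‖(x : EuclideanSpace ℝ (Fin n))‖ ^ 2)) ≤
      max 1 (c ^ (-(n : ℝ) / 2)) *
        ∑' x : L, Real.exp (-π * ‖(x : EuclideanSpace ℝ (Fin n))‖ ^ 2) := by
  have hA₀ : 0 ≤ ∑' x : L, Real.exp (-π * ‖(x : EuclideanSpace ℝ (Fin n))‖ ^ 2) :=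
    tsum_nonneg fun _ ↦ Real.exp_nonneg _
  rcases le_or_gt 1 c with h1 | h1
  · refine le_trans ?_ (le_mul_of_one_le_left hA₀ (le_max_left _ _))
    simp only [neg_mul π c]
    refine (summable_exp_neg_mul_norm_sq L (by positivity)).tsum_le_tsum (fun x ↦ ?_)
      (summable_exp_neg_mul_norm_sq L Real.pi_pos)
    gcongr
    nlinarith [Real.pi_pos]
  · refine le_trans ?_ (mul_le_mul_of_nonneg_right (le_max_right _ _) hA₀)
    simpa using tsum_exp_neg_mul_norm_sq_le_rpow_mul L Real.pi_pos hc h1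
end
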